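/- Let H be an m×n real matrix with full column rank and let S be an (algebraic) observability set, i.e., H^(−S) has nontrivial kernel while for every k ∈ S the matrix H^(−(S∖{k})) has trivial kernel. Then the kernel of H^(−S) is one-dimensional; equivalently, rank H^(−S) = n − 1, so removing the observability set decreases the rank of the Jacobian matrix by exactly 1. (Algebraic form of Theorem 2) -/

import Mathlib

/-- The submatrix of `H` obtained by deleting the rows indexed by `S`. -/
def delRows {m n : ℕ} (H : Matrix (Fin m) (Fin n) ℝ) (S : Set (Fin m)) :
    Matrix {i : Fin m // i ∉ S} (Fin n) ℝ :=
  Matrix.of fun i j => H i.1 j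

open Matrix in
theorem delRows_mulVec_eq_zero_iff {m n : ℕ} (H : Matrix (Fin m) (Fin n) ℝ) (S : Set (Fin m))
    (c : Fin n → ℝ) : delRows H S *ᵥ c = 0 ↔ ∀ i ∉ S, (H *ᵥ c) i = 0 :=
  ⟨fun h i hi => congrFun h ⟨i, hi⟩, fun h => funext fun i => h i.1 i.2⟩

theorem Matrix.rank_add_finrank_ker_mulVecLin {K m n : Type*} [Field K] [Fintype n]
    (A : Matrix m n K) :
    A.rank + Module.finrank K (LinearMap.ker A.mulVecLin) = Fintype.card n := by
  rw [Matrix.rank, LinearMap.finrank_range_add_finrank_ker, Module.finrank_fintype_fun_eq_card]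

/-- Algebraic form of Theorem 2: if `H` has full column rank and `S` is an (algebraic)
observability set (`H^(−S)` has nontrivial kernel while adding back any row of `S` makes
the kernel trivial), then `rank H^(−S) = n − 1`: removing the observability set decreases
the rank of the Jacobian by exactly 1 (equivalently, the kernel is one-dimensional). -/
theorem removing_observability_set_decreases_rank_by_one
    {m n : ℕ} (H : Matrix (Fin m) (Fin n) ℝ) (hH : H.rank = n) (S : Set (Fin m))
    (hker : ∃ c : Fin n → ℝ, c ≠ 0 ∧ (delRows H S).mulVec c = 0)
    (hmin : ∀ k ∈ S, ∀ c : Fin n → ℝ, (delRows H (S \ {k})).mulVec c = 0 → c = 0) :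
    (delRows H S).rank = n - 1 := by
  obtain ⟨c, hc, hSc⟩ := hker
  rw [delRows_mulVec_eq_zero_iff] at hSc
  obtain ⟨k, hk⟩ : S.Nonempty := by
    by_contra hS
    rw [Set.not_nonempty_iff_eq_empty] at hS
    have hr := H.rank_add_finrank_ker_mulVecLin
    rw [hH, Fintype.card_fin, Nat.add_eq_left, Submodule.finrank_eq_zero] at hr
    refine hc ((Submodule.mem_bot ℝ).1 (hr ▸ LinearMap.mem_ker.2 ?_))
    ext i
    exact hSc i (by simp [hS])
  have key (d : Fin n → ℝ) (hd : ∀ i ∉ S, H.mulVec d i = 0) (hdk : H.mulVec d k = 0) :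
      d = 0 := by
    refine hmin k hk d ((delRows_mulVec_eq_zero_iff _ _ _).2 fun i hi => ?_)
    by_cases hik : i = k
    · rwa [hik]
    · exact hd i fun hiS => hi ⟨hiS, hik⟩
  have hck : H.mulVec c k ≠ 0 := fun h => hc (key c hSc h)
  have hfin : Module.finrank ℝ (LinearMap.ker (delRows H S).mulVecLin) = 1 := by
    refine (finrank_eq_one_iff_of_nonzero'
      (⟨c, (delRows_mulVec_eq_zero_iff H S c).2 hSc⟩ :
        LinearMap.ker (delRows H S).mulVecLin) (fun h => hc (congrArg Subtype.val h))).2 ?_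
    rintro ⟨d, hd⟩
    have hSd := (delRows_mulVec_eq_zero_iff H S d).1 hd
    refine ⟨H.mulVec d k / H.mulVec c k, Subtype.ext (sub_eq_zero.1 (key _ ?_ ?_))⟩
    · intro i hi
      simp [Matrix.mulVec_sub, Matrix.mulVec_smul, hSc i hi, hSd i hi]
    · simp [Matrix.mulVec_sub, Matrix.mulVec_smul, hck]
  have hr := (delRows H S).rank_add_finrank_ker_mulVecLin
  rw [hfin, Fintype.card_fin] at hr
  omega
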